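/- arXiv:1211.4725 — 5 statements merged into one kernel-verified Lean document; each statement's English description precedes it below -/
import Mathlib

section
/- Let n ≥ 1 and let f : ℂ^{n+1} × ℝ → ℂ be smooth (as a map of real vector spaces) with f(0;λ) = 0 for all λ. For 0 ≤ i ≤ n write a_i(λ) := D_{X_i} f(0;λ) : ℂ → ℂ (a real-linear map). Assume: (i) there is ω₀ ≠ 0 with a_0(0)v = iω₀·v for all v ∈ ℂ; (ii) the normal form symmetry f(e^{iω₀s}X_0, …, e^{iω₀s}X_{n−1}, 0; λ) = e^{iω₀s} f(X_0, …, X_{n−1}, 0; λ) holds for all s ∈ ℝ, all X and λ; (iii) a_0(0) + a_1(0) + ⋯ + a_n(0) is invertible; (iv) (d/dλ)|_{λ=0} tr a_0(λ) ≠ 0; (v) tr a_1(0) ≠ 0; (vi) ∂³(Re f)(0;0)/∂(Re X_0)³ ≠ 0. Set κ_i := 1/(2·3^{i−1}). Then there exist λ₀ > 0, a sign ε ∈ {+1, −1}, a continuous function ω : [0, λ₀) → ℝ with ω(0) = ω₀, and for each i = 1, …, n continuous functions B_i (defined for ελ ∈ [0, λ₀)) with values in ℂ of the form B_i(λ) =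 |λ|^{κ_i} Z_i(|λ|^{κ_i}) for some smooth Z_i with Z_i(0) ≠ 0 (so |B_i(λ)| ∼ |λ|^{κ_i}), such that for every r = 1, …, n the functions x_j(t) := 0 for 0 ≤ j ≤ r−1 and x_j(t) := B_{j−r+1}(λ) e^{iω(λ)t} for r ≤ j ≤ n form a periodic solution of the feed-forward system dx_j/dt = f(x_{σ_0(j)}, x_{σ_1(j)}, …, x_{σ_n(j)}; λ) for all 0 < ελ < λ₀. -/
/-- The semigroup maps `σ_i(j) = max (j - i) 0` of the feed-forward chain. -/
def ffidx (n : ℕ) (i : ℕ) (j : Fin (n + 1)) : Fin (n + 1) :=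
  ⟨j.val - i, Nat.lt_of_le_of_lt (Nat.sub_le _ _) j.isLt⟩

/-- The real-linear partial derivative `a_i(λ) = D_{X_i} f(0;λ) : ℂ → ℂ`. -/
noncomputable def ffDi (n : ℕ) (f : (Fin (n + 1) → ℂ) → ℝ → ℂ) (i : Fin (n + 1))
    (lam : ℝ) : Module.End ℝ ℂ :=
  (fderiv ℝ (fun X => f X lam) 0).toLinearMap ∘ₗ
    LinearMap.single ℝ (fun _ : Fin (n + 1) => ℂ) i

/-- The Hopf-branch Ansatz: cells `0, …, r-1` are zero, cell `m ≥ r` is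
`B_{m-r+1}(λ)·e^{iω(λ)t}`. -/
noncomputable def hopfSol (B : ℕ → ℝ → ℂ) (ω : ℝ → ℝ) (r : ℕ) (lam t : ℝ)
    (m : ℕ) : ℂ :=
  if m < r then 0 else B (m - r + 1) lam * Complex.exp (Complex.I * (ω lam) * t)

/-- The exponent `κ_i = 1/(2·3^{i-1})`. -/
noncomputable def hopfKappa (i : ℕ) : ℝ := 1 / (2 * 3 ^ (i - 1))

section Branches

open Set Filter Topology MeasureTheory
open scoped ContDiff

universe u

theorem hasFDerivAt_intervalIntegral_of_contDiff {E F : Type*} [NormedAddCommGroup E]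
    [NormedSpace ℝ E] [FiniteDimensional ℝ E] [NormedAddCommGroup F] [NormedSpace ℝ F]
    {g : E × ℝ → F} (hg : ContDiff ℝ 1 g) (a b : ℝ) (x₀ : E) :
    HasFDerivAt (fun x => ∫ s in a..b, g (x, s))
      (∫ s in a..b, (fderiv ℝ g (x₀, s)).comp (.inl ℝ E ℝ)) x₀ := by
  have : ProperSpace E := FiniteDimensional.proper_real E
  have hg' : Continuous fun p : E × ℝ => (fderiv ℝ g p).comp (.inl ℝ E ℝ) :=
    (hg.continuous_fderiv one_ne_zero).clm_comp continuous_const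
  obtain ⟨C, hC⟩ := ((isCompact_closedBall x₀ 1).prod
    (isCompact_uIcc (a := a) (b := b))).exists_bound_of_continuousOn hg'.continuousOn
  refine intervalIntegral.hasFDerivAt_integral_of_dominated_of_fderiv_le
    (F' := fun x s => (fderiv ℝ g (x, s)).comp (.inl ℝ E ℝ)) (bound := fun _ => C)
    (Metric.closedBall_mem_nhds x₀ one_pos) ?_ ?_ ?_ ?_ ?_ ?_
  · exact .of_forall fun x => (hg.continuous.comp (by fun_prop)).aestronglyMeasurable
  · exact (hg.continuous.comp (by fun_prop)).intervalIntegrable _ _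
  · exact (hg'.comp (by fun_prop : Continuous fun s : ℝ => (x₀, s))).aestronglyMeasurable
  · exact .of_forall fun s hs x hx => hC (x, s) ⟨hx, uIoc_subset_uIcc hs⟩
  · exact intervalIntegrable_const
  · refine .of_forall fun s _ x _ => ?_
    exact ((hg.differentiable one_ne_zero) (x, s)).hasFDerivAt.comp x (hasFDerivAt_prodMk_left x s)

theorem contDiff_intervalIntegral {E F : Type u} [NormedAddCommGroup E]
    [NormedSpace ℝ E] [FiniteDimensional ℝ E] [NormedAddCommGroup F] [NormedSpace ℝ F]
    {g : E × ℝ → F} (hg : ContDiff ℝ ∞ g) (a b : ℝ) :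
    ContDiff ℝ ∞ fun x => ∫ s in a..b, g (x, s) := by
  refine contDiff_infty.2 fun k => ?_
  induction k generalizing F with
  | zero =>
    refine contDiff_zero.2 (continuous_iff_continuousAt.2 fun x => ?_)
    exact (hasFDerivAt_intervalIntegral_of_contDiff (hg.of_le (by simp)) a b x).continuousAt
  | succ k ih =>
    have hd := hasFDerivAt_intervalIntegral_of_contDiff (hg.of_le (by simp)) a b
    rw [Nat.cast_succ, contDiff_succ_iff_fderiv]
    refine ⟨fun x => (hd x).differentiableAt, by simp, ?_⟩
    rw [funext fun x => (hd x).fderiv]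
    have : ContDiff ℝ ∞ (fderiv ℝ g) := hg.fderiv_right (by simp)
    exact ih (g := fun p => (fderiv ℝ g p).comp (.inl ℝ E ℝ)) (by fun_prop)

/-- Hadamard's lemma with parameters. -/
theorem ContDiff.exists_eq_add_smul {E F : Type u} [NormedAddCommGroup E]
    [NormedSpace ℝ E] [FiniteDimensional ℝ E] [NormedAddCommGroup F] [NormedSpace ℝ F]
    [CompleteSpace F] {K : ℝ × E → F} (hK : ContDiff ℝ ∞ K) :
    ∃ L : ℝ × E → F, ContDiff ℝ ∞ L ∧ ∀ t x, K (t, x) = K (0, x) + t • L (t, x) := by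
  let g : (ℝ × E) × ℝ → F := fun p => fderiv ℝ K (p.2 * p.1.1, p.1.2) (1, 0)
  have hg : ContDiff ℝ ∞ g := by
    have : ContDiff ℝ ∞ (fderiv ℝ K) := hK.fderiv_right (by simp)
    fun_prop
  refine ⟨fun p => ∫ s in (0:ℝ)..1, g (p, s), contDiff_intervalIntegral hg 0 1, fun t x => ?_⟩
  have hd : ∀ s ∈ uIcc (0:ℝ) 1, HasDerivAt (fun s => K (s * t, x)) (t • g ((t, x), s)) s := by
    intro s _
    have h1 := ((hK.differentiable (by simp)) (s * t, x)).hasFDerivAt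
    have h2 : HasDerivAt (fun s : ℝ => (s * t, x)) (t, 0) s := by
      simpa using ((hasDerivAt_id s).mul_const t).prodMk (hasDerivAt_const s x)
    have h3 := h1.comp_hasDerivAt s h2
    rwa [show ((t, 0) : ℝ × E) = t • (1, 0) by simp, map_smul] at h3
  have := intervalIntegral.integral_eq_sub_of_hasDerivAt hd
    ((by fun_prop : Continuous fun s => t • g ((t, x), s)).intervalIntegrable _ _)
  rw [intervalIntegral.integral_smul] at this
  simp [this]

theorem exists_contDiff_eventuallyEq {E F : Type*} [NormedAddCommGroup E]
    [NormedSpace ℝ E] [FiniteDimensional ℝ E] [NormedAddCommGroup F] [NormedSpace ℝ F] {x₀ : E}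
    {g : E → F} (hg : ∀ᶠ x in 𝓝 x₀, ContDiffAt ℝ ∞ g x) :
    ∃ G : E → F, ContDiff ℝ ∞ G ∧ G =ᶠ[𝓝 x₀] g := by
  obtain ⟨ε, hε, h⟩ := Metric.eventually_nhds_iff_ball.1 hg
  let b : ContDiffBump x₀ := ⟨ε / 4, ε / 2, by positivity, by linarith⟩
  refine ⟨fun x => b x • g x, contDiff_iff_contDiffAt.2 fun x => ?_, ?_⟩
  · by_cases hx : x ∈ Metric.ball x₀ ε
    · exact b.contDiff.contDiffAt.smul (h x hx)
    · refine contDiffAt_const (c := (0 : F)) |>.congr_of_eventuallyEq ?_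
      have : x ∉ tsupport b := by
        rw [b.tsupport_eq]
        intro hx'
        refine hx (Metric.closedBall_subset_ball ?_ hx')
        change ε / 2 < ε
        linarith
      filter_upwards [notMem_tsupport_iff_eventuallyEq.1 this] with y hy
      simp [hy]
  · filter_upwards [b.eventuallyEq_one] with x hx
    simp [hx]

theorem exists_contDiff_implicit {E F : Type*} [NormedAddCommGroup E]
    [NormedSpace ℝ E] [FiniteDimensional ℝ E] [NormedAddCommGroup F] [NormedSpace ℝ F]
    [FiniteDimensional ℝ F] {H : E × F → F} {x₀ : E} {z₀ : F}
    (hH : ∀ᶠ p in 𝓝 (x₀, z₀), ContDiffAt ℝ ∞ H p) (h0 : H (x₀, z₀) = 0)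
    {D : F →L[ℝ] F} (hD : HasFDerivAt (fun z => H (x₀, z)) D z₀) (hinj : Function.Injective D) :
    ∃ Z : E → F, ContDiff ℝ ∞ Z ∧ Z x₀ = z₀ ∧ ∀ᶠ x in 𝓝 x₀, H (x, Z x) = 0 := by
  have : CompleteSpace E := FiniteDimensional.complete ℝ E
  have : CompleteSpace F := FiniteDimensional.complete ℝ F
  have c0 := hH.self_of_nhds
  have hn : (∞ : WithTop ℕ∞) ≠ 0 := by simp
  have hD' : fderiv ℝ H (x₀, z₀) ∘L .inr ℝ E F = D :=
    HasFDerivAt.unique ((c0.differentiableAt hn).hasFDerivAt.comp z₀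
      (hasFDerivAt_prodMk_right x₀ z₀)) hD
  have if₂ : (fderiv ℝ H (x₀, z₀) ∘L .inr ℝ E F).IsInvertible := by
    rw [hD']
    exact ⟨(LinearEquiv.ofInjectiveEndo D.toLinearMap hinj).toContinuousLinearEquiv, by ext; rfl⟩
  have hinv : ∀ᶠ p in 𝓝 (x₀, z₀), (fderiv ℝ H p ∘L .inr ℝ E F).IsInvertible := by
    have : ContinuousAt (fun p => fderiv ℝ H p ∘L .inr ℝ E F) (x₀, z₀) := by
      have := (c0.fderiv_right (m := 0) (by simp)).continuousAt
      fun_prop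
    exact this.eventually (ContinuousLinearEquiv.isOpen.mem_nhds if₂)
  set ψ := c0.implicitFunction hn if₂ with hψ
  have hψ0 : ψ x₀ = z₀ := c0.implicitFunction_apply_self hn if₂
  have hψz : ∀ᶠ x in 𝓝 x₀, H (x, ψ x) = 0 := by
    simpa [h0] using c0.eventually_apply_implicitFunction hn if₂
  have hψc : ∀ᶠ x in 𝓝 x₀, ContinuousAt ψ x := by
    have := (c0.contDiffAt_implicitFunction hn if₂).of_le (m := 1) (by simp)
    filter_upwards [this.eventually (by simp)] with x hx using hx.continuousAt
  have hψt : Tendsto (fun x => (x, ψ x)) (𝓝 x₀) (𝓝 (x₀, z₀)) := by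
    have := hψc.self_of_nhds
    rw [ContinuousAt, hψ0] at this
    exact tendsto_id.prodMk_nhds this
  have hψs : ∀ᶠ x in 𝓝 x₀, ContDiffAt ℝ ∞ ψ x := by
    filter_upwards [hψt.eventually hH, hψt.eventually hinv, hψz.eventually_nhds, hψc]
      with x c1 i1 z1 cx
    refine (c1.contDiffAt_implicitFunction hn i1).congr_of_eventuallyEq ?_
    have ht : Tendsto (fun y => (y, ψ y)) (𝓝 x) (𝓝 (x, ψ x)) := tendsto_id.prodMk_nhds cx
    filter_upwards [z1, ht.eventually (c1.eventually_apply_eq_iff_implicitFunction hn i1)]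
      with y hy h
    exact (h.1 (hy.trans z1.self_of_nhds.symm)).symm
  obtain ⟨Z, hZ, hZe⟩ := exists_contDiff_eventuallyEq hψs
  refine ⟨Z, hZ, hZe.self_of_nhds.trans hψ0, ?_⟩
  filter_upwards [hZe, hψz] with x h1 h2
  rw [h1, h2]

/-- A smooth rotation-equivariant map is `x ↦ x * (p + ‖x‖ ^ 2 * q ‖x‖)` with smooth `p`, `q`. -/
theorem exists_radial_expansion {h : ℂ × ℝ → ℂ} (hh : ContDiff ℝ ∞ h)
    (heq : ∀ (u : ℂ) (x : ℂ) (lam : ℝ), ‖u‖ = 1 → h (u * x, lam) = u * h (x, lam)) :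
    ∃ (p : ℝ → ℂ) (q : ℝ × ℝ → ℂ), ContDiff ℝ ∞ p ∧ ContDiff ℝ ∞ q ∧
      (∀ R lam : ℝ, h (R, lam) = R * (p lam + R ^ 2 * q (R, lam))) ∧
      ∀ (x : ℂ) (lam : ℝ), h (x, lam) = x * (p lam + ‖x‖ ^ 2 * q (‖x‖, lam)) := by
  have hodd : ∀ (x : ℂ) (lam : ℝ), h (-x, lam) = -h (x, lam) := fun x lam => by
    simpa using heq (-1) x lam (by simp)
  have hK : ContDiff ℝ ∞ fun x : ℝ × ℝ => h ((x.1 : ℂ), x.2) :=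
    hh.comp ((Complex.ofRealCLM.contDiff.comp contDiff_fst).prodMk contDiff_snd)
  obtain ⟨L₁, hL₁, h₁⟩ := hK.exists_eq_add_smul
  obtain ⟨L₂, hL₂, h₂⟩ := hL₁.exists_eq_add_smul
  obtain ⟨L₃, hL₃, h₃⟩ := hL₂.exists_eq_add_smul
  have hzero : ∀ lam : ℝ, h (0, lam) = 0 := fun lam => by
    have := hodd 0 lam
    rw [neg_zero] at this
    exact self_eq_neg.1 this
  have hL₂0 : ∀ lam, L₂ (0, lam) = 0 := fun lam => by
    have hc : (fun R : ℝ => L₂ (R, lam) + L₂ (-R, lam)) = fun _ => 0 := by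
      have := hL₂.continuous
      refine Continuous.ext_on (dense_compl_singleton (0 : ℝ)) (by fun_prop) (by fun_prop) ?_
      intro R hR
      have e1 := h₁ R lam
      have e2 := h₁ (-R) lam
      rw [h₂ R lam] at e1
      rw [h₂ (-R) lam] at e2
      simp only [Complex.ofReal_neg, hodd, Complex.ofReal_zero, hzero, Complex.real_smul] at e1 e2
      have hR' : (R : ℂ) ≠ 0 := by simpa using hR
      have : (R : ℂ) ^ 2 * (L₂ (R, lam) + L₂ (-R, lam)) = 0 := by linear_combination -e1 - e2
      simpa [hR'] using this
    have := congrFun hc 0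
    simp only [neg_zero] at this
    exact self_eq_neg.1 (eq_neg_of_add_eq_zero_left this)
  have hreal : ∀ R lam : ℝ, h (R, lam) = R * (L₁ (0, lam) + R ^ 2 * L₃ (R, lam)) := by
    intro R lam
    rw [h₁ R lam, h₂ R lam, h₃ R lam, hL₂0]
    simp only [Complex.ofReal_zero, hzero, Complex.real_smul]
    ring
  refine ⟨fun lam => L₁ (0, lam), L₃, by fun_prop, hL₃, hreal, fun x lam => ?_⟩
  rcases eq_or_ne x 0 with rfl | hx
  · simp [hzero]
  have hx' : (‖x‖ : ℂ) ≠ 0 := by simpa using hx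
  have e : x / ‖x‖ * ‖x‖ = x := div_mul_cancel₀ _ hx'
  have := heq (x / ‖x‖) ‖x‖ lam (by simp [hx])
  rw [e, hreal, ← mul_assoc, e] at this
  exact this

theorem deriv_pow_succ_mul {g : ℝ → ℝ} (hg : ContDiff ℝ ∞ g) (k : ℕ) :
    deriv (fun t => t ^ (k + 1) * g t) = fun t => t ^ k * ((k + 1) * g t + t * deriv g t) := by
  ext t
  have := ((hasDerivAt_pow (k + 1) t).mul ((hg.differentiable (by simp)) t).hasDerivAt).deriv
  simp only [Nat.cast_add, Nat.cast_one, Nat.add_sub_cancel] at this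
  refine Eq.trans this ?_
  ring

theorem iteratedDeriv_three_mul_add_cube {g : ℝ → ℝ} (hg : ContDiff ℝ ∞ g) (c : ℝ) :
    iteratedDeriv 3 (fun t => t * (c + t ^ 2 * g t)) 0 = 6 * g 0 := by
  have hd : ∀ {g : ℝ → ℝ}, ContDiff ℝ ∞ g → ContDiff ℝ ∞ (deriv g) := fun h =>
    ((contDiff_infty_iff_deriv).1 h).2
  let g₂ := fun t => 3 * g t + t * deriv g t
  let g₃ := fun t => 2 * g₂ t + t * deriv g₂ t
  have hg' := hd hg
  have hg₂ : ContDiff ℝ ∞ g₂ := by fun_prop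
  have hg₂' := hd hg₂
  have hg₃ : ContDiff ℝ ∞ g₃ := by fun_prop
  have e₁ : deriv (fun t => t * (c + t ^ 2 * g t)) = fun t => c + t ^ 2 * g₂ t := by
    have : (fun t => t * (c + t ^ 2 * g t)) = fun t => c * t + t ^ (2 + 1) * g t := by
      ext t; ring
    rw [this]
    have h2 := deriv_pow_succ_mul hg 2
    ext t
    have hdiff : Differentiable ℝ g := hg.differentiable (by simp)
    rw [deriv_fun_add (by fun_prop) (by fun_prop), h2]
    simp [g₂]
    norm_num
  have e₂ : deriv (fun t => c + t ^ 2 * g₂ t) = fun t => t * g₃ t := by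
    have h2 := deriv_pow_succ_mul hg₂ 1
    ext t
    rw [deriv_const_add, h2]
    simp [g₃]
    norm_num
  have e₃ : deriv (fun t => t * g₃ t) 0 = g₃ 0 := by
    have h2 := deriv_pow_succ_mul hg₃ 0
    simpa using congrFun h2 0
  rw [iteratedDeriv_succ, iteratedDeriv_succ, iteratedDeriv_one, e₁, e₂, e₃]
  simp [g₃, g₂]
  ring

/-- The amplitude of the first branch scales like the square root of the parameter. -/
theorem exists_first_branch {p : ℝ → ℂ} {q : ℝ × ℝ → ℂ} (hp : ContDiff ℝ ∞ p)
    (hq : ContDiff ℝ ∞ q) (hp0 : (p 0).re = 0) (hp1 : deriv (fun lam => (p lam).re) 0 ≠ 0)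
    (hq0 : (q (0, 0)).re ≠ 0) :
    ∃ ε : ℝ, (ε = 1 ∨ ε = -1) ∧ ∃ y : ℝ → ℝ, ContDiff ℝ ∞ y ∧ 0 < y 0 ∧
      ∀ᶠ m in 𝓝 (0 : ℝ),
        (p (ε * m ^ 2) + (m * y m : ℝ) ^ 2 * q (m * y m, ε * m ^ 2)).re = 0 := by
  have hre : ContDiff ℝ ∞ fun lam => (p lam).re := Complex.reCLM.contDiff.comp hp
  obtain ⟨s, hs, hs'⟩ := (hre.comp (contDiff_fst (E := ℝ) (F := ℝ))).exists_eq_add_smul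
  have hps : ∀ lam, (p lam).re = lam * s (lam, 0) := fun lam => by
    simpa [hp0] using hs' lam 0
  have ha : deriv (fun lam => (p lam).re) 0 = s (0, 0) := by
    have h2 := deriv_pow_succ_mul (g := fun t => s (t, 0)) (by fun_prop) 0
    simp_rw [hps]
    simpa using congrFun h2 0
  rw [ha] at hp1
  set α := s (0, 0)
  set C := (q (0, 0)).re
  obtain ⟨ε, hε, hεC⟩ : ∃ ε : ℝ, (ε = 1 ∨ ε = -1) ∧ 0 < -(ε * α / C) := by
    rcases lt_or_gt_of_ne (div_ne_zero hp1 hq0) with h | h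
    · exact ⟨1, .inl rfl, by simpa using h⟩
    · exact ⟨-1, .inr rfl, by simpa [neg_div] using h⟩
  have hqre : ContDiff ℝ ∞ fun x => (q x).re := Complex.reCLM.contDiff.comp hq
  let H : ℝ × ℝ → ℝ := fun x =>
    ε * s (ε * x.1 ^ 2, 0) + x.2 ^ 2 * (q (x.1 * x.2, ε * x.1 ^ 2)).re
  have hH : ContDiff ℝ ∞ H := by
    have h1 : ContDiff ℝ ∞ fun x : ℝ × ℝ => (q (x.1 * x.2, ε * x.1 ^ 2)).re :=
      hqre.comp (by fun_prop)
    fun_prop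
  set y₀ := √(-(ε * α / C)) with hy₀
  have hy₀pos : 0 < y₀ := Real.sqrt_pos.2 hεC
  have hsq : y₀ ^ 2 = -(ε * α / C) := Real.sq_sqrt hεC.le
  have hD : HasFDerivAt (fun y => H (0, y))
      (ContinuousLinearMap.toSpanSingleton ℝ (2 * y₀ * C)) y₀ := by
    have : (fun y => H (0, y)) = fun y => ε * α + y ^ 2 * C := by
      ext y; simp [H, α, C]
    rw [this]
    simpa using (((hasDerivAt_pow 2 y₀).mul_const C).const_add (ε * α)).hasFDerivAt
  obtain ⟨y, hy, hy0, hyz⟩ := exists_contDiff_implicit (H := H) (x₀ := (0 : ℝ)) (z₀ := y₀)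
    (.of_forall fun x => hH.contDiffAt)
    (by simp only [H]; simp [hsq, α]; change ε * α + -(ε * α / C * C) = 0; field_simp; simp) hD (by
      intro u v huv
      have : 2 * y₀ * C ≠ 0 := by positivity
      simpa [this, hy₀pos.ne', hq0] using huv)
  refine ⟨ε, hε, y, hy, hy0 ▸ hy₀pos, ?_⟩
  filter_upwards [hyz] with m hm
  simp only [H] at hm
  rw [← Complex.ofReal_pow, Complex.add_re, Complex.re_ofReal_mul, hps]
  linear_combination m ^ 2 * hm

theorem exists_next_branch {q : ℝ × ℝ → ℂ} (hq : ContDiff ℝ ∞ q) (hq0 : q (0, 0) ≠ 0)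
    {l : ℝ → ℝ} (hl : ContDiff ℝ ∞ l) (hl0 : l 0 = 0)
    {c : ℝ → ℂ} (hc : ContDiff ℝ ∞ c) (hc0 : c 0 = 0)
    {M : ℝ × ℂ → ℂ} (hM : ContDiff ℝ ∞ M) {d : ℂ} (hd : d ≠ 0) (hM0 : ∀ z, M (0, z) = d) :
    ∃ Z : ℝ → ℂ, ContDiff ℝ ∞ Z ∧ Z 0 ≠ 0 ∧ ∀ᶠ v in 𝓝 (0 : ℝ),
      Z v * (‖Z v‖ ^ 2 * q (v * ‖Z v‖, l v) - c v) + M (v, Z v) = 0 := by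
  let H : ℝ × ℂ → ℂ := fun x =>
    x.2 * (‖x.2‖ ^ 2 * q (x.1 * ‖x.2‖, l x.1) - c x.1) + M x
  set u := -d / q (0, 0) with hu
  have hune : u ≠ 0 := div_ne_zero (neg_ne_zero.2 hd) hq0
  have hupos : 0 < ‖u‖ := norm_pos_iff.2 hune
  obtain ⟨r, hr, hru⟩ : ∃ r : ℝ, 0 < r ∧ r ^ 3 = ‖u‖ :=
    ⟨‖u‖ ^ (1 / 3 : ℝ), by positivity, by
      rw [← Real.rpow_natCast, ← Real.rpow_mul hupos.le]; norm_num⟩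
  set z₀ : ℂ := u / (r : ℂ) ^ 2 with hz₀
  have hrC : (r : ℂ) ≠ 0 := by exact_mod_cast hr.ne'
  have hz₀n : ‖z₀‖ = r := by
    rw [hz₀, norm_div, ← hru, norm_pow, Complex.norm_real, Real.norm_of_nonneg hr.le]
    field_simp
  have hz₀ne : z₀ ≠ 0 := norm_pos_iff.1 (hz₀n ▸ hr)
  have hH : ∀ᶠ x in 𝓝 ((0 : ℝ), z₀), ContDiffAt ℝ ∞ H x := by
    have : ∀ᶠ x in 𝓝 ((0 : ℝ), z₀), x.2 ≠ 0 :=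
      continuousAt_snd.eventually_ne hz₀ne
    filter_upwards [this] with x hx
    have h1 : ContDiffAt ℝ ∞ (fun x : ℝ × ℂ => ‖x.2‖) x := contDiffAt_snd.norm ℝ hx
    have h2 : ContDiffAt ℝ ∞ (fun x : ℝ × ℂ => (‖x.2‖ : ℂ)) x :=
      Complex.ofRealCLM.contDiff.contDiffAt.comp x h1
    have h3 : ContDiffAt ℝ ∞ (fun x : ℝ × ℂ => q (x.1 * ‖x.2‖, l x.1)) x :=
      hq.contDiffAt.comp x ((contDiffAt_fst.mul h1).prodMk (hl.contDiffAt.comp x contDiffAt_fst))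
    have h4 : ContDiffAt ℝ ∞ (fun x : ℝ × ℂ => c x.1) x := hc.contDiffAt.comp x contDiffAt_fst
    exact (contDiffAt_snd.mul (((h2.pow 2).mul h3).sub h4)).add hM.contDiffAt
  have hH0 : ∀ z, H (0, z) = q (0, 0) * ((‖z‖ ^ 2 : ℝ) • z) + d := fun z => by
    simp only [H, zero_mul, hl0, hc0, hM0, sub_zero, Complex.real_smul]
    push_cast
    ring
  let D : ℂ →L[ℝ] ℂ := (ContinuousLinearMap.mul ℝ ℂ (q (0, 0))).comp
    (‖z₀‖ ^ 2 • ContinuousLinearMap.id ℝ ℂ + (2 • (innerSL ℝ z₀)).smulRight z₀)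
  have hD : HasFDerivAt (fun z => H (0, z)) D z₀ := by
    simp_rw [hH0]
    have h1 : HasFDerivAt (fun z : ℂ => ‖z‖ ^ 2) (2 • (innerSL ℝ z₀)) z₀ :=
      (hasStrictFDerivAt_norm_sq z₀).hasFDerivAt
    exact (((ContinuousLinearMap.mul ℝ ℂ (q (0, 0))).hasFDerivAt.comp z₀
      (h1.smul (hasFDerivAt_id z₀)))).add_const d
  have hinj : Function.Injective D := by
    rw [injective_iff_map_eq_zero]
    intro v hv
    have hv1 : ‖z₀‖ ^ 2 • v + (2 * inner ℝ z₀ v) • z₀ = 0 := by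
      have h1 : q (0, 0) * (‖z₀‖ ^ 2 • v + (2 • inner ℝ z₀ v) • z₀) = 0 := hv
      rw [nsmul_eq_mul, Nat.cast_ofNat] at h1
      exact (mul_eq_zero.1 h1).resolve_left hq0
    have hv2 := congrArg (inner ℝ z₀) hv1
    simp only [inner_add_right, inner_smul_right, inner_zero_right,
      real_inner_self_eq_norm_sq] at hv2
    have hv3 : inner ℝ z₀ v = 0 := by
      have : ‖z₀‖ ^ 2 * inner ℝ z₀ v = 0 := by linarith
      simpa [hz₀ne] using this
    simpa [hv3, hz₀ne] using hv1
  obtain ⟨Z, hZ, hZ0, hZz⟩ := exists_contDiff_implicit hH (by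
    rw [hH0, hz₀n, Complex.real_smul, hz₀, hu]
    push_cast
    field_simp
    ring) hD hinj
  exact ⟨Z, hZ, hZ0 ▸ hz₀ne, hZz⟩

section ResponseFunction

variable {n : ℕ} {f : (Fin (n + 1) → ℂ) → ℝ → ℂ}

theorem response_unit_mul {ω₀ : ℝ} (hω₀ : ω₀ ≠ 0)
    (hsym : ∀ (s lam : ℝ) (X : Fin (n + 1) → ℂ), X (Fin.last n) = 0 →
      f (fun j => Complex.exp (Complex.I * ω₀ * s) * X j) lam
        = Complex.exp (Complex.I * ω₀ * s) * f X lam)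
    {u : ℂ} (hu : ‖u‖ = 1) (lam : ℝ) {X : Fin (n + 1) → ℂ} (hX : X (Fin.last n) = 0) :
    f (u • X) lam = u * f X lam := by
  have h := hsym (u.arg / ω₀) lam X hX
  have he : Complex.exp (Complex.I * ω₀ * (u.arg / ω₀ : ℝ)) = u := by
    have := Complex.norm_mul_exp_arg_mul_I u
    rw [hu, Complex.ofReal_one, one_mul] at this
    have hω : (ω₀ : ℂ) ≠ 0 := by exact_mod_cast hω₀
    rw [← this, this]
    push_cast
    rw [show Complex.I * ω₀ * (u.arg / ω₀) = u.arg * Complex.I by field_simp, this]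
  rw [he] at h
  exact h

theorem hasDerivAt_ffDi
    (hf : ContDiff ℝ ∞ fun p : (Fin (n + 1) → ℂ) × ℝ => f p.1 p.2)
    (i : Fin (n + 1)) (lam : ℝ) (v : ℂ) :
    HasDerivAt (fun t : ℝ => f (Pi.single i (t * v)) lam) (ffDi n f i lam v) 0 := by
  have h1 : ContDiff ℝ ∞ fun X => f X lam :=
    hf.comp (by fun_prop : ContDiff ℝ ∞ fun X => (X, lam))
  have h2 : HasDerivAt (fun t : ℝ => t • (Pi.single i v : Fin (n + 1) → ℂ)) (Pi.single i v) 0 := by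
    simpa using (hasDerivAt_id (0 : ℝ)).smul_const (Pi.single i v : Fin (n + 1) → ℂ)
  have h3 : HasFDerivAt (fun X => f X lam) (fderiv ℝ (fun X => f X lam) 0)
      ((0 : ℝ) • (Pi.single i v : Fin (n + 1) → ℂ)) := by
    rw [zero_smul]
    exact ((h1.differentiable (by simp)) 0).hasFDerivAt
  have h4 := h3.comp_hasDerivAt 0 h2
  simpa [Function.comp_def, ← Pi.single_smul, ffDi] using h4

theorem ffDi_unit_mul
    (hf : ContDiff ℝ ∞ fun p : (Fin (n + 1) → ℂ) × ℝ => f p.1 p.2)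
    (hequiv : ∀ (u : ℂ) (lam : ℝ) (X : Fin (n + 1) → ℂ), ‖u‖ = 1 → X (Fin.last n) = 0 →
      f (u • X) lam = u * f X lam)
    {i : Fin (n + 1)} (hi : i ≠ Fin.last n) (lam : ℝ) {u : ℂ} (hu : ‖u‖ = 1) (v : ℂ) :
    ffDi n f i lam (u * v) = u * ffDi n f i lam v := by
  refine (hasDerivAt_ffDi hf i lam (u * v)).unique ?_
  convert! (hasDerivAt_ffDi hf i lam v).const_mul u using 2 with t
  rw [← hequiv u lam _ hu (by simp [hi.symm]), ← Pi.single_smul, smul_eq_mul]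
  congr 2
  ring

theorem ffDi_eq_mul
    (hf : ContDiff ℝ ∞ fun p : (Fin (n + 1) → ℂ) × ℝ => f p.1 p.2)
    (hequiv : ∀ (u : ℂ) (lam : ℝ) (X : Fin (n + 1) → ℂ), ‖u‖ = 1 → X (Fin.last n) = 0 →
      f (u • X) lam = u * f X lam)
    {i : Fin (n + 1)} (hi : i ≠ Fin.last n) (lam : ℝ) :
    ffDi n f i lam = LinearMap.mulRight ℝ (ffDi n f i lam 1) := by
  refine Complex.basisOneI.ext fun j => ?_
  fin_cases j
  · simp
  · simpa using ffDi_unit_mul hf hequiv hi lam (u := Complex.I) (by simp) 1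

theorem trace_ffDi
    (hf : ContDiff ℝ ∞ fun p : (Fin (n + 1) → ℂ) × ℝ => f p.1 p.2)
    (hequiv : ∀ (u : ℂ) (lam : ℝ) (X : Fin (n + 1) → ℂ), ‖u‖ = 1 → X (Fin.last n) = 0 →
      f (u • X) lam = u * f X lam)
    {i : Fin (n + 1)} (hi : i ≠ Fin.last n) (lam : ℝ) :
    LinearMap.trace ℝ ℂ (ffDi n f i lam) = 2 * (ffDi n f i lam 1).re := by
  have h := Algebra.trace_complex_apply (ffDi n f i lam 1)
  rw [Algebra.trace_apply] at h
  rw [← h, ffDi_eq_mul hf hequiv hi lam]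
  congr 1
  ext x
  simp [mul_comm]

/-- The vector of inputs of the `i`-th nonzero cell of a feed-forward chain, for cell amplitudes
`v ^ 3 ^ k * Z (i - k) (v ^ 3 ^ k)` and vanishing remaining inputs. -/
noncomputable def branchProfile (n : ℕ) (Z : ℕ → ℝ → ℂ) (i : ℕ) (v : ℝ) : Fin (n + 1) → ℂ :=
  fun k => if k.val < i then ((v ^ 3 ^ k.val : ℝ) : ℂ) * Z (i - k.val) (v ^ 3 ^ k.val) else 0

theorem branchProfile_congr {Z W : ℕ → ℝ → ℂ} {i : ℕ} (h : ∀ j, 1 ≤ j → j ≤ i → Z j = W j)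
    (v : ℝ) : branchProfile n Z i v = branchProfile n W i v := by
  ext k
  simp only [branchProfile]
  split_ifs with hk
  · rw [h (i - k) (by omega) (by omega)]
  · rfl

/-- A branch of the `i`-th nonzero cell with amplitude the cube root of the preceding one. -/
theorem exists_amplified_branch
    (hf : ContDiff ℝ ∞ fun p : (Fin (n + 1) → ℂ) × ℝ => f p.1 p.2)
    (ha : ∀ w : ℂ, w ≠ 0 → ffDi n f 1 0 w ≠ 0)
    {p : ℝ → ℂ} {q : ℝ × ℝ → ℂ} (hq : ContDiff ℝ ∞ q) (hq0 : q (0, 0) ≠ 0)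
    (hpq : ∀ (x : ℂ) (lam : ℝ), f (Pi.single 0 x) lam = x * (p lam + ‖x‖ ^ 2 * q (‖x‖, lam)))
    {y : ℝ → ℝ} (hy : ContDiff ℝ ∞ y) (ε : ℝ)
    {Z : ℕ → ℝ → ℂ} (hZ : ∀ j, ContDiff ℝ ∞ (Z j)) {i : ℕ} (hi : 2 ≤ i) (hin : i ≤ n)
    (hZi : Z (i - 1) 0 ≠ 0) :
    ∃ W : ℝ → ℂ, ContDiff ℝ ∞ W ∧ W 0 ≠ 0 ∧ ∀ᶠ v in 𝓝[>] (0 : ℝ), ∀ m : ℝ, m = v ^ 3 ^ (i - 1) →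
      f (branchProfile n (Function.update Z i W) i v) (ε * m ^ 2)
        = (p (ε * m ^ 2) + (m * y m : ℝ) ^ 2 * q (m * y m, ε * m ^ 2)) * (v * W v) := by
  let Y : ℝ × (ℝ × ℂ) → Fin (n + 1) → ℂ := fun x k =>
    if k.val = 0 then x.2.1 * x.2.2
    else if k.val < i then
      ((x.1 * x.2.1 ^ (3 ^ k.val - 3) : ℝ) : ℂ) * Z (i - k.val) (x.2.1 ^ 3 ^ k.val) else 0
  let l : ℝ → ℝ := fun v => ε * (v ^ 3 ^ (i - 1)) ^ 2
  have hl : ContDiff ℝ ∞ l := by fun_prop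
  have hofReal : ContDiff ℝ ∞ (fun t : ℝ => (t : ℂ)) := Complex.ofRealCLM.contDiff
  have hY : ContDiff ℝ ∞ Y := by
    refine contDiff_pi.2 fun k => ?_
    simp only [Y]
    split_ifs
    · exact (hofReal.comp (by fun_prop)).mul (by fun_prop)
    · exact (hofReal.comp (by fun_prop)).mul ((hZ _).comp (by fun_prop))
    · exact contDiff_const
  have hK : ContDiff ℝ ∞ fun x => f (Y x) (l x.2.1) :=
    hf.comp (hY.prodMk (hl.comp (by fun_prop)))
  obtain ⟨L, hL, hKL⟩ := hK.exists_eq_add_smul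
  have hY0 : ∀ x, Y (0, x) = Pi.single 0 (x.1 * x.2) := fun x => by
    ext k
    rcases eq_or_ne k 0 with rfl | hk
    · simp [Y]
    · simp [Y, hk]
  have hpow : 3 ≤ 3 ^ (i - 1) := by
    calc 3 = 3 ^ 1 := rfl
      _ ≤ 3 ^ (i - 1) := Nat.pow_le_pow_right (by norm_num) (by omega)
  have hl0 : l 0 = 0 := by
    simp [l]
  have hone : (1 : Fin (n + 1)).val = 1 := by
    rw [Fin.val_one']
    exact Nat.mod_eq_of_lt (by omega)
  have hY1 : ∀ t z, Y (t, (0, z)) = Pi.single 1 (t * Z (i - 1) 0) := fun t z => by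
    ext k
    rcases eq_or_ne k 1 with rfl | hk
    · simp only [Y, hone, one_ne_zero, if_false, if_pos (show 1 < i by omega), Pi.single_eq_same]
      simp
    · have hk1 : k.val ≠ 1 := fun h => hk (Fin.ext (h.trans hone.symm))
      simp only [Y, ne_eq, hk, not_false_eq_true, Pi.single_eq_of_ne]
      split_ifs with h1 h2
      · simp
      · have : 3 ^ 2 ≤ 3 ^ k.val := Nat.pow_le_pow_right (by norm_num) (by omega)
        rw [zero_pow (by omega)]
        simp
      · rfl
  have hL0 : ∀ z, L (0, (0, z)) = ffDi n f 1 0 (Z (i - 1) 0) := fun z => by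
    refine HasDerivAt.unique ?_ (hasDerivAt_ffDi hf 1 0 (Z (i - 1) 0))
    have h1 : (fun t : ℝ => f (Pi.single 1 (t * Z (i - 1) 0)) 0) =
        fun t => f (Y (0, (0, z))) 0 + t • L (t, (0, z)) := by
      ext t
      have := hKL t (0, z)
      rwa [hY1 t, hl0] at this
    rw [h1]
    have h2 : DifferentiableAt ℝ (fun t => L (t, (0, z))) 0 :=
      (hL.comp (by fun_prop : ContDiff ℝ ∞ fun t : ℝ => (t, ((0 : ℝ), z)))).differentiable
        (by simp) 0
    simpa using ((hasDerivAt_id (0 : ℝ)).smul h2.hasDerivAt).const_add (f (Y (0, (0, z))) 0)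
  let c : ℝ → ℂ := fun v => ((v ^ (2 * 3 ^ (i - 1) - 2) * y (v ^ 3 ^ (i - 1)) ^ 2 : ℝ) : ℂ) *
    q (v ^ 3 ^ (i - 1) * y (v ^ 3 ^ (i - 1)), l v)
  have hc : ContDiff ℝ ∞ c := (hofReal.comp (by fun_prop)).mul (hq.comp (by fun_prop))
  have hc0 : c 0 = 0 := by
    simp only [c]
    rw [zero_pow (by omega)]
    simp
  obtain ⟨W, hW, hW0, hWe⟩ := exists_next_branch hq hq0 hl hl0 hc hc0
    (M := fun x => L (x.1 ^ 3, x)) (by fun_prop) (ha _ hZi) (fun z => by simp [hL0])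
  refine ⟨W, hW, hW0, ?_⟩
  filter_upwards [hWe.filter_mono nhdsWithin_le_nhds, self_mem_nhdsWithin] with v hv hvpos m hm
  have hprof : branchProfile n (Function.update Z i W) i v = Y (v ^ 3, (v, W v)) := by
    ext k
    simp only [branchProfile, Y]
    by_cases hk : k.val = 0
    · simp [hk, show 0 < i by omega]
    · have h3 : 3 ^ 1 ≤ 3 ^ k.val := Nat.pow_le_pow_right (by norm_num) (by omega)
      rw [if_neg hk, Function.update_of_ne (by omega), ← pow_add,
        show 3 + (3 ^ k.val - 3) = 3 ^ k.val by omega]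
  have hnorm : ‖(v : ℂ) * W v‖ = v * ‖W v‖ := by
    rw [norm_mul, Complex.norm_real, Real.norm_of_nonneg (le_of_lt hvpos)]
  have hlm : ε * m ^ 2 = l v := by rw [hm]
  have hmc : ((m * y m : ℝ) : ℂ) ^ 2 * q (m * y m, l v) = v ^ 2 * c v := by
    have : (m * y m) ^ 2 = v ^ 2 * (v ^ (2 * 3 ^ (i - 1) - 2) * y m ^ 2) := by
      rw [← mul_assoc, ← pow_add, show 2 + (2 * 3 ^ (i - 1) - 2) = 3 ^ (i - 1) * 2 by omega,
        pow_mul, ← hm, mul_pow]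
    simp only [c, ← hm]
    rw [← Complex.ofReal_pow, this]
    push_cast
    ring
  rw [hprof, hlm, hmc]
  have h := hKL (v ^ 3) (v, W v)
  simp only [hY0, hpq, hnorm] at h
  rw [h, Complex.real_smul]
  push_cast
  linear_combination (v : ℂ) ^ 3 * hv

theorem exists_branch_sequence
    (hf : ContDiff ℝ ∞ fun p : (Fin (n + 1) → ℂ) × ℝ => f p.1 p.2)
    (ha : 2 ≤ n → ∀ w : ℂ, w ≠ 0 → ffDi n f 1 0 w ≠ 0)
    {p : ℝ → ℂ} {q : ℝ × ℝ → ℂ} (hq : ContDiff ℝ ∞ q) (hq0 : q (0, 0) ≠ 0)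
    (hpq : ∀ (x : ℂ) (lam : ℝ), f (Pi.single 0 x) lam = x * (p lam + ‖x‖ ^ 2 * q (‖x‖, lam)))
    (hpq' : ∀ R lam : ℝ, f (Pi.single 0 (R : ℂ)) lam = R * (p lam + R ^ 2 * q (R, lam)))
    {y : ℝ → ℝ} (hy : ContDiff ℝ ∞ y) (hy0 : y 0 ≠ 0) (ε : ℝ) :
    ∃ Z : ℕ → ℝ → ℂ, (∀ j, ContDiff ℝ ∞ (Z j)) ∧
      ∀ i, 1 ≤ i → i ≤ n → Z i 0 ≠ 0 ∧
      ∀ᶠ v in 𝓝[>] (0 : ℝ), ∀ m : ℝ, m = v ^ 3 ^ (i - 1) →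
      f (branchProfile n Z i v) (ε * m ^ 2)
        = (p (ε * m ^ 2) + (m * y m : ℝ) ^ 2 * q (m * y m, ε * m ^ 2)) * (v * Z i v) := by
  suffices H : ∀ k, ∃ Z : ℕ → ℝ → ℂ, (∀ j, ContDiff ℝ ∞ (Z j)) ∧
      ∀ i, 1 ≤ i → i ≤ n → i ≤ k + 1 → Z i 0 ≠ 0 ∧
      ∀ᶠ v in 𝓝[>] (0 : ℝ), ∀ m : ℝ, m = v ^ 3 ^ (i - 1) →
      f (branchProfile n Z i v) (ε * m ^ 2)
        = (p (ε * m ^ 2) + (m * y m : ℝ) ^ 2 * q (m * y m, ε * m ^ 2)) * (v * Z i v) by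
    obtain ⟨Z, h1, h3⟩ := H n
    exact ⟨Z, h1, fun i hi hin => h3 i hi hin (by omega)⟩
  intro k
  induction k with
  | zero =>
    refine ⟨fun _ v => y v, fun _ => Complex.ofRealCLM.contDiff.comp hy,
      fun i hi _ hi' => ?_⟩
    obtain rfl : i = 1 := by omega
    refine ⟨by simpa using hy0, .of_forall fun v m hm => ?_⟩
    obtain rfl : m = v := by simpa using hm
    have : branchProfile n (fun _ v => (y v : ℂ)) 1 m = Pi.single 0 ((m * y m : ℝ) : ℂ) := by
      ext k
      rcases eq_or_ne k 0 with rfl | hk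
      · simp [branchProfile]
      · simp [branchProfile, hk]
    rw [this, hpq']
    push_cast
    ring
  | succ k ih =>
    obtain ⟨Z, h1, h3⟩ := ih
    by_cases hkn : k + 2 ≤ n
    · obtain ⟨W, hW, hW0, hWe⟩ := exists_amplified_branch hf (ha (by omega)) hq hq0 hpq hy ε h1
        (i := k + 2) (by omega) hkn (h3 (k + 1) (by omega) (by omega) le_rfl).1
      refine ⟨Function.update Z (k + 2) W, fun j => ?_, fun i hi hin hik => ?_⟩
      · rcases eq_or_ne j (k + 2) with rfl | hj
        · simpa using hW
        · simpa [hj] using h1 j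
      · rcases eq_or_ne i (k + 2) with rfl | hj
        · rw [Function.update_self]
          exact ⟨hW0, hWe⟩
        · have := h3 i hi hin (by omega)
          rw [Function.update_of_ne hj]
          refine ⟨this.1, this.2.mono fun v hv => ?_⟩
          rwa [branchProfile_congr (W := Z) fun j _ hj' => Function.update_of_ne (by omega) _ _]
    · exact ⟨Z, h1, fun i hi hin _ => h3 i hi hin (by omega)⟩

theorem ffDi_one_ne_zero
    (hf : ContDiff ℝ ∞ fun p : (Fin (n + 1) → ℂ) × ℝ => f p.1 p.2)
    (hequiv : ∀ (u : ℂ) (lam : ℝ) (X : Fin (n + 1) → ℂ), ‖u‖ = 1 → X (Fin.last n) = 0 →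
      f (u • X) lam = u * f X lam)
    {i : Fin (n + 1)} (hi : i ≠ Fin.last n) {lam : ℝ}
    (htr : LinearMap.trace ℝ ℂ (ffDi n f i lam) ≠ 0) {w : ℂ} (hw : w ≠ 0) :
    ffDi n f i lam w ≠ 0 := by
  rw [trace_ffDi hf hequiv hi] at htr
  rw [ffDi_eq_mul hf hequiv hi]
  refine mul_ne_zero hw fun h => htr ?_
  simp [h]

theorem ffDi_zero_apply_one
    (hf : ContDiff ℝ ∞ fun p : (Fin (n + 1) → ℂ) × ℝ => f p.1 p.2)
    {p : ℝ → ℂ} {q : ℝ × ℝ → ℂ} (hq : ContDiff ℝ ∞ q)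
    (hpq : ∀ R lam : ℝ, f (Pi.single 0 (R : ℂ)) lam = R * (p lam + R ^ 2 * q (R, lam)))
    (lam : ℝ) : ffDi n f 0 lam 1 = p lam := by
  refine (hasDerivAt_ffDi hf 0 lam 1).unique ?_
  have hofReal : ContDiff ℝ ∞ (fun t : ℝ => (t : ℂ)) := Complex.ofRealCLM.contDiff
  have h : ContDiff ℝ ∞ fun R : ℝ => p lam + R ^ 2 * q (R, lam) := by fun_prop
  simp only [mul_one, hpq, ← Complex.real_smul]
  convert! (hasDerivAt_id (0 : ℝ)).smul ((h.differentiable (by simp)) 0).hasDerivAt using 1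
  simp

theorem hopfSol_feedForward
    (hf0 : ∀ lam : ℝ, f 0 lam = 0)
    (hequiv : ∀ (u : ℂ) (lam : ℝ) (X : Fin (n + 1) → ℂ), ‖u‖ = 1 → X (Fin.last n) = 0 →
      f (u • X) lam = u * f X lam)
    {B : ℕ → ℝ → ℂ} {w : ℝ → ℝ} {lam : ℝ}
    (hB : ∀ m : ℕ, 1 ≤ m → m ≤ n →
      f (fun k => if k.val < m then B (m - k.val) lam else 0) lam = Complex.I * w lam * B m lam)
    {r : ℕ} (hr : 1 ≤ r) (t : ℝ) (j : Fin (n + 1)) :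
    HasDerivAt (fun t' : ℝ => hopfSol B w r lam t' j.val)
      (f (fun i : Fin (n + 1) => hopfSol B w r lam t ((ffidx n i.val j).val)) lam) t := by
  have hidx : ∀ k : Fin (n + 1), (ffidx n k.val j).val = j.val - k.val := fun _ => rfl
  by_cases hj : j.val < r
  · have h : (fun k : Fin (n + 1) => hopfSol B w r lam t ((ffidx n k.val j).val)) = 0 := by
      ext k
      rw [hidx, hopfSol, if_pos (by omega), Pi.zero_apply]
    rw [h, hf0]
    simpa [hopfSol, hj] using hasDerivAt_const t (0 : ℂ)
  · set u := Complex.exp (Complex.I * w lam * t) with hu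
    have hu1 : ‖u‖ = 1 := by
      rw [hu, show Complex.I * w lam * t = ((w lam * t : ℝ) : ℂ) * Complex.I by push_cast; ring,
        Complex.norm_exp_ofReal_mul_I]
    have h : (fun k : Fin (n + 1) => hopfSol B w r lam t ((ffidx n k.val j).val)) =
        u • fun k : Fin (n + 1) => if k.val < j.val - r + 1 then B (j.val - r + 1 - k.val) lam
          else 0 := by
      ext k
      rw [hidx, hopfSol, Pi.smul_apply, smul_eq_mul]
      by_cases hk : k.val < j.val - r + 1
      · rw [if_neg (by omega), if_pos hk, mul_comm,
          show j.val - k.val - r + 1 = j.val - r + 1 - k.val by omega]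
      · rw [if_pos (by omega), if_neg hk, mul_zero]
    rw [h, hequiv u lam _ hu1 (if_neg (by rw [Fin.val_last]; omega)), hB _ (by omega) (by omega)]
    simp only [hopfSol, if_neg hj]
    have h1 : HasDerivAt (fun t' : ℝ => Complex.I * w lam * (t' : ℂ)) (Complex.I * w lam) t := by
      simpa using (Complex.ofRealCLM.hasDerivAt (x := t)).const_mul (Complex.I * w lam)
    convert! h1.cexp.const_mul (B (j.val - r + 1) lam) using 1
    ring

end ResponseFunction

theorem hopfKappa_pos (i : ℕ) : 0 < hopfKappa i := by
  unfold hopfKappa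
  positivity

theorem rpow_hopfKappa_pow {s : ℝ} (hs : 0 ≤ s) {i k : ℕ} (h : k < i) :
    (s ^ hopfKappa i) ^ 3 ^ k = s ^ hopfKappa (i - k) := by
  rw [← Real.rpow_natCast, ← Real.rpow_mul hs, hopfKappa, hopfKappa]
  congr 1
  rw [show i - 1 = i - k - 1 + k by omega, pow_add]
  push_cast
  field_simp

theorem tendsto_rpow_nhdsGT_zero {k : ℝ} (hk : 0 < k) :
    Tendsto (fun s : ℝ => s ^ k) (𝓝[>] 0) (𝓝[>] 0) := by
  refine tendsto_nhdsWithin_iff.2 ⟨?_, ?_⟩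
  · have := (Real.continuous_rpow_const hk.le).tendsto 0
    rw [Real.zero_rpow hk.ne'] at this
    exact this.mono_left nhdsWithin_le_nhds
  · filter_upwards [self_mem_nhdsWithin] with s hs using Real.rpow_pos_of_pos hs k

end Branches

/-- **amplified Hopf branches.** For a smooth normal-form response
function `f : ℂ^{n+1} × ℝ → ℂ` with `f(0;λ) = 0`, `a_0(0) = iω₀` (`ω₀ ≠ 0`),
the normal form symmetry, and the generic conditions, there are branches of
periodic solutions of the feed-forward chain with amplitudes
`|B_i(λ)| ∼ |λ|^{1/(2·3^{i-1})}` and frequency `ω(λ) → ω₀`. -/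
theorem amplified_hopf_bifurcation (n : ℕ) (hn : 1 ≤ n)
    (f : (Fin (n + 1) → ℂ) → ℝ → ℂ)
    (hsmooth : ContDiff ℝ (⊤ : ℕ∞) fun p : (Fin (n + 1) → ℂ) × ℝ => f p.1 p.2)
    (hf0 : ∀ lam : ℝ, f 0 lam = 0)
    (ω₀ : ℝ) (hω₀ : ω₀ ≠ 0)
    (ha0 : ∀ v : ℂ, ffDi n f 0 0 v = Complex.I * ω₀ * v)
    (hsym : ∀ (s lam : ℝ) (X : Fin (n + 1) → ℂ), X (Fin.last n) = 0 →
      f (fun j => Complex.exp (Complex.I * ω₀ * s) * X j) lam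
        = Complex.exp (Complex.I * ω₀ * s) * f X lam)
    (hinv : IsUnit (∑ i : Fin (n + 1), ffDi n f i 0))
    (hcross : deriv (fun lam => LinearMap.trace ℝ ℂ (ffDi n f 0 lam)) 0 ≠ 0)
    (hnilp : LinearMap.trace ℝ ℂ (ffDi n f 1 0) ≠ 0)
    (hcubic : iteratedDeriv 3 (fun t : ℝ => (f (Pi.single 0 ((t : ℝ) : ℂ)) 0).re) 0 ≠ 0) :
    ∃ lam₀ > (0 : ℝ), ∃ ε : ℝ, (ε = 1 ∨ ε = -1) ∧
      ∃ (ω : ℝ → ℝ) (B Z : ℕ → ℝ → ℂ),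
        ContinuousOn ω {lam : ℝ | ε * lam ∈ Set.Ico 0 lam₀} ∧ ω 0 = ω₀ ∧
        (∀ i : ℕ, 1 ≤ i → i ≤ n →
          ContDiffOn ℝ (⊤ : ℕ∞) (Z i) (Set.Ico 0 (lam₀ ^ hopfKappa i)) ∧
          Z i 0 ≠ 0 ∧
          ContinuousOn (B i) {lam : ℝ | ε * lam ∈ Set.Ico 0 lam₀} ∧
          (∀ lam : ℝ, ε * lam ∈ Set.Ico 0 lam₀ →
            B i lam = ((|lam| ^ hopfKappa i : ℝ) : ℂ) * Z i (|lam| ^ hopfKappa i))) ∧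
        ∀ r : ℕ, 1 ≤ r → r ≤ n →
          ∀ lam : ℝ, 0 < ε * lam → ε * lam < lam₀ →
            ∀ (t : ℝ) (j : Fin (n + 1)),
              HasDerivAt (fun t' : ℝ => hopfSol B ω r lam t' j.val)
                (f (fun i : Fin (n + 1) =>
                  hopfSol B ω r lam t ((ffidx n i.val j).val)) lam) t := by
  have hequiv : ∀ (u : ℂ) (lam : ℝ) (X : Fin (n + 1) → ℂ), ‖u‖ = 1 → X (Fin.last n) = 0 →
      f (u • X) lam = u * f X lam := fun u lam X hu hX =>
    response_unit_mul hω₀ hsym hu lam hX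
  have h0last : (0 : Fin (n + 1)) ≠ Fin.last n := fun h => by
    have := congrArg Fin.val h
    simp at this
    omega
  have hsingle : ContDiff ℝ (⊤ : ℕ∞) fun x : ℂ × ℝ => f (Pi.single 0 x.1) x.2 := by
    have : ContDiff ℝ (⊤ : ℕ∞) fun x : ℂ => (Pi.single 0 x : Fin (n + 1) → ℂ) :=
      (ContinuousLinearMap.single ℝ (fun _ : Fin (n + 1) => ℂ) 0).contDiff
    exact hsmooth.comp ((this.comp contDiff_fst).prodMk contDiff_snd)
  obtain ⟨p, q, hp, hq, hpq', hpq⟩ := exists_radial_expansion hsingle fun u x lam hu => by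
    rw [← smul_eq_mul u x, Pi.single_smul]
    exact hequiv u lam _ hu (by simp [h0last.symm])
  have hp1 : ∀ lam, ffDi n f 0 lam 1 = p lam := ffDi_zero_apply_one hsmooth hq hpq'
  have hp0 : p 0 = Complex.I * ω₀ := by rw [← hp1, ha0, mul_one]
  have hpre : Differentiable ℝ fun lam => (p lam).re :=
    (Complex.reCLM.contDiff.comp hp).differentiable (by simp)
  have hcross' : deriv (fun lam => (p lam).re) 0 ≠ 0 := by
    simp_rw [trace_ffDi hsmooth hequiv h0last, hp1] at hcross
    rw [deriv_const_mul _ (hpre 0)] at hcross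
    exact right_ne_zero_of_mul hcross
  have hq0 : (q (0, 0)).re ≠ 0 := by
    have hg : ContDiff ℝ (⊤ : ℕ∞) fun t : ℝ => (q (t, 0)).re :=
      Complex.reCLM.contDiff.comp (hq.comp (contDiff_id.prodMk contDiff_const))
    have h : (fun t : ℝ => (f (Pi.single 0 ((t : ℝ) : ℂ)) 0).re) =
        fun t => t * ((p 0).re + t ^ 2 * (q (t, 0)).re) := by
      ext t
      rw [hpq', ← Complex.ofReal_pow, Complex.re_ofReal_mul, Complex.add_re, Complex.re_ofReal_mul]
    rw [h, iteratedDeriv_three_mul_add_cube hg] at hcubic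
    exact right_ne_zero_of_mul hcubic
  obtain ⟨ε, hε, y, hy, hy0, hyre⟩ :=
    exists_first_branch hp hq (by simp [hp0]) hcross' hq0
  have ha1 : 2 ≤ n → ∀ w : ℂ, w ≠ 0 → ffDi n f 1 0 w ≠ 0 := fun hn2 w hw => by
    refine ffDi_one_ne_zero hsmooth hequiv (fun h => ?_) hnilp hw
    have := congrArg Fin.val h
    rw [Fin.val_one', Nat.mod_eq_of_lt (by omega), Fin.val_last] at this
    omega
  obtain ⟨Z, hZ, hZi⟩ := exists_branch_sequence hsmooth ha1 hq
    (fun h => hq0 (by simp [h])) hpq hpq' hy hy0.ne' ε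
  have hev : ∀ᶠ s in nhdsWithin (0 : ℝ) (Set.Ioi 0),
      (p (ε * (s ^ hopfKappa 1) ^ 2) + ((s ^ hopfKappa 1 * y (s ^ hopfKappa 1) : ℝ) : ℂ) ^ 2 *
        q (s ^ hopfKappa 1 * y (s ^ hopfKappa 1), ε * (s ^ hopfKappa 1) ^ 2)).re = 0 ∧
      ∀ i ∈ Finset.Icc 1 n, ∀ m : ℝ, m = (s ^ hopfKappa i) ^ 3 ^ (i - 1) →
        f (branchProfile n Z i (s ^ hopfKappa i)) (ε * m ^ 2)
          = (p (ε * m ^ 2) + (m * y m : ℝ) ^ 2 * q (m * y m, ε * m ^ 2)) *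
            ((s ^ hopfKappa i : ℝ) * Z i (s ^ hopfKappa i)) := by
    refine Filter.Eventually.and ?_ ((Finset.eventually_all _).2 fun i hi => ?_)
    · exact (tendsto_rpow_nhdsGT_zero (hopfKappa_pos 1)).eventually
        (hyre.filter_mono nhdsWithin_le_nhds)
    · rw [Finset.mem_Icc] at hi
      exact (tendsto_rpow_nhdsGT_zero (hopfKappa_pos i)).eventually (hZi i hi.1 hi.2).2
  obtain ⟨lam₀, hlam₀, hsub⟩ := mem_nhdsGT_iff_exists_Ioo_subset.1 hev
  have hrpow : ∀ i, Continuous fun lam : ℝ => |lam| ^ hopfKappa i := fun i =>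
    continuous_abs.rpow_const fun _ => .inr (hopfKappa_pos i).le
  have hofReal : Continuous fun lam : ℝ => (lam : ℂ) := Complex.continuous_ofReal
  refine ⟨lam₀, hlam₀, ε, hε,
    fun lam => (p lam + ((|lam| ^ hopfKappa 1 * y (|lam| ^ hopfKappa 1) : ℝ) : ℂ) ^ 2 *
      q (|lam| ^ hopfKappa 1 * y (|lam| ^ hopfKappa 1), lam)).im,
    fun i lam => ((|lam| ^ hopfKappa i : ℝ) : ℂ) * Z i (|lam| ^ hopfKappa i), Z, ?_, ?_, ?_, ?_⟩
  · have hpc := hp.continuous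
    have hqc := hq.continuous
    have hyc := hy.continuous
    have h1 := hrpow 1
    exact Continuous.continuousOn (by fun_prop)
  · simp [hp0, (hopfKappa_pos 1).ne']
  · intro i hi hin
    have hZc := (hZ i).continuous
    have h1 := hrpow i
    exact ⟨(hZ i).contDiffOn, (hZi i hi hin).1, Continuous.continuousOn (by fun_prop),
      fun _ _ => rfl⟩
  · intro r hr _ lam hlam hlam' t j
    have habs : |lam| = ε * lam := by
      rcases hε with rfl | rfl
      · rw [one_mul] at hlam ⊢
        exact abs_of_pos hlam
      · rw [neg_one_mul] at hlam ⊢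
        exact abs_of_neg (by linarith)
    have hεlam : ε * (|lam| ^ hopfKappa 1) ^ 2 = lam := by
      rw [← Real.rpow_natCast, ← Real.rpow_mul (abs_nonneg _), hopfKappa]
      norm_num
      rw [habs, ← mul_assoc]
      rcases hε with rfl | rfl <;> norm_num
    obtain ⟨hre, hbr⟩ := hsub (show |lam| ∈ Set.Ioo 0 lam₀ by rw [habs]; exact ⟨hlam, hlam'⟩)
    refine hopfSol_feedForward hf0 hequiv (fun m hm hmn => ?_) hr t j
    have hpow : ∀ k, k < m → (|lam| ^ hopfKappa m) ^ 3 ^ k = |lam| ^ hopfKappa (m - k) :=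
      fun k hk => rpow_hopfKappa_pow (abs_nonneg _) hk
    have hfm := hbr m (Finset.mem_Icc.2 ⟨hm, hmn⟩) (|lam| ^ hopfKappa 1) (by
      rw [hpow _ (by omega), show m - (m - 1) = 1 by omega])
    rw [hεlam] at hre hfm
    have hprof : branchProfile n Z m (|lam| ^ hopfKappa m) = fun k => if k.val < m then
        ((|lam| ^ hopfKappa (m - k.val) : ℝ) : ℂ) *
          Z (m - k.val) (|lam| ^ hopfKappa (m - k.val)) else 0 := by
      ext k
      simp only [branchProfile]
      split_ifs with hk
      · rw [hpow _ hk]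
      · rfl
    rw [hprof] at hfm
    rw [hfm]
    congr 1
    apply Complex.ext
    · simpa using hre
    · simp
end

section
/- Let n ≥ 1 and let V be a finite-dimensional real vector space. For f, g ∈ C^∞(V^{n+1}, V) define [f, g]_Σ ∈ C^∞(V^{n+1}, V) by [f, g]_Σ(X) = Σ_{i=0}^n D_i f(X)·g(A_{σ_i}X) − D_i g(X)·f(A_{σ_i}X), where D_i denotes the partial Fréchet derivative in the i-th V-variable. Then the Lie bracket of the feed-forward vector fields γ_f and γ_g, defined by [γ_f, γ_g](x) = Dγ_f(x)·γ_g(x) − Dγ_g(x)·γ_f(x), satisfies [γ_f, γ_g] = γ_{[f,g]_Σ}. In particular the set {γ_f : f ∈ C^∞(V^{n+1}, V)} is closed under the Lie bracket of vector fields. -/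
/-- The feed-forward vector field `γ_f`, `(γ_f)_j(x) = f(x_{σ_0(j)}, …, x_{σ_n(j)})`
with `σ_i(j) = max (j-i) 0`. -/
def gammaFF (n : ℕ) {V : Type*} (f : (Fin (n + 1) → V) → V) (x : Fin (n + 1) → V) :
    Fin (n + 1) → V :=
  fun j => f fun i : Fin (n + 1) =>
    x ⟨j.val - i.val, Nat.lt_of_le_of_lt (Nat.sub_le _ _) j.isLt⟩

/-- The linear map `A_{σ_i}`, `(A_{σ_i} X)_j = X_{min (j+i) n}`, as a plain function. -/
def ffAmap (n : ℕ) {V : Type*} (i : Fin (n + 1)) (X : Fin (n + 1) → V) :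
    Fin (n + 1) → V :=
  fun j => X ⟨min (j.val + i.val) n, Nat.lt_succ_of_le (min_le_right _ _)⟩

/-- The pullback `x ↦ (x_{σ_0(j)}, …, x_{σ_n(j)})` as a continuous linear map. -/
def ffPullback (n : ℕ) (V : Type*) [NormedAddCommGroup V] [NormedSpace ℝ V] (j : Fin (n + 1)) :
    (Fin (n + 1) → V) →L[ℝ] (Fin (n + 1) → V) :=
  ContinuousLinearMap.pi fun i : Fin (n + 1) =>
    ContinuousLinearMap.proj ⟨j.val - i.val, Nat.lt_of_le_of_lt (Nat.sub_le _ _) j.isLt⟩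

theorem gammaFF_apply_eq_comp_ffPullback (n : ℕ) {V : Type*} [NormedAddCommGroup V]
    [NormedSpace ℝ V] (f : (Fin (n + 1) → V) → V) (x : Fin (n + 1) → V) (j : Fin (n + 1)) :
    gammaFF n f x j = f (ffPullback n V j x) :=
  rfl

theorem ffPullback_gammaFF_apply (n : ℕ) {V : Type*} [NormedAddCommGroup V] [NormedSpace ℝ V]
    (g : (Fin (n + 1) → V) → V) (x : Fin (n + 1) → V) (j i : Fin (n + 1)) :
    ffPullback n V j (gammaFF n g x) i = g (ffAmap n i (ffPullback n V j x)) := by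
  change g _ = g _
  congr 1
  funext k
  change x _ = x _
  congr 1
  ext
  have := j.isLt
  simp only
  omega

theorem fderiv_gammaFF_apply (n : ℕ) {V : Type*} [NormedAddCommGroup V] [NormedSpace ℝ V]
    {f : (Fin (n + 1) → V) → V} (hf : Differentiable ℝ f) (x v : Fin (n + 1) → V)
    (j : Fin (n + 1)) :
    fderiv ℝ (gammaFF n f) x v j = fderiv ℝ f (ffPullback n V j x) (ffPullback n V j v) := by
  have h : HasFDerivAt (gammaFF n f) (ContinuousLinearMap.pi fun j =>
      (fderiv ℝ f (ffPullback n V j x)).comp (ffPullback n V j)) x :=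
    hasFDerivAt_pi.2 fun j =>
      (hf (ffPullback n V j x)).hasFDerivAt.comp x (ffPullback n V j).hasFDerivAt
  rw [h.fderiv]
  rfl

theorem fderiv_gammaFF_gammaFF_apply (n : ℕ) {V : Type*} [NormedAddCommGroup V]
    [NormedSpace ℝ V] {f : (Fin (n + 1) → V) → V} (hf : Differentiable ℝ f)
    (g : (Fin (n + 1) → V) → V) (x : Fin (n + 1) → V) (j : Fin (n + 1)) :
    fderiv ℝ (gammaFF n f) x (gammaFF n g x) j =
      ∑ i, fderiv ℝ f (ffPullback n V j x)
        (Pi.single i (g (ffAmap n i (ffPullback n V j x)))) := by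
  rw [fderiv_gammaFF_apply n hf, ← map_sum]
  congr 1
  rw [← Finset.univ_sum_single (ffPullback n V j (gammaFF n g x))]
  simp only [ffPullback_gammaFF_apply]

/-- The Lie bracket of two feed-forward vector fields `γ_f, γ_g`
is the feed-forward vector field of
`[f,g]_Σ(X) = Σ_i D_i f(X)·g(A_{σ_i}X) - D_i g(X)·f(A_{σ_i}X)`;
in particular the feed-forward vector fields are closed under the Lie bracket. -/
theorem feedforward_bracket (n : ℕ) (hn : 1 ≤ n) (V : Type*)
    [NormedAddCommGroup V] [NormedSpace ℝ V] [FiniteDimensional ℝ V]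
    (f g : (Fin (n + 1) → V) → V)
    (hf : ContDiff ℝ (⊤ : ℕ∞) f) (hg : ContDiff ℝ (⊤ : ℕ∞) g) :
    (∀ x : Fin (n + 1) → V,
      fderiv ℝ (gammaFF n f) x (gammaFF n g x) - fderiv ℝ (gammaFF n g) x (gammaFF n f x)
        = gammaFF n (fun X => ∑ i : Fin (n + 1),
            (fderiv ℝ f X (Pi.single i (g (ffAmap n i X)))
              - fderiv ℝ g X (Pi.single i (f (ffAmap n i X))))) x) ∧
    ∃ h : (Fin (n + 1) → V) → V, ∀ x : Fin (n + 1) → V,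
      fderiv ℝ (gammaFF n f) x (gammaFF n g x) - fderiv ℝ (gammaFF n g) x (gammaFF n f x)
        = gammaFF n h x := by
  have hf' : Differentiable ℝ f := hf.differentiable (by simp)
  have hg' : Differentiable ℝ g := hg.differentiable (by simp)
  refine (fun h => ⟨h, _, h⟩) fun x => ?_
  funext j
  rw [Pi.sub_apply, fderiv_gammaFF_gammaFF_apply n hf', fderiv_gammaFF_gammaFF_apply n hg',
    gammaFF_apply_eq_comp_ffPullback, Finset.sum_sub_distrib]
end

section
/- Let n ≥ 1, let V be a finite-dimensional real vector space, and let a_0, ā_1, …, ā_n ∈ End(V) satisfy a_0 ā_i = ā_i a_0 for all 1 ≤ i ≤ n−1. Let Ā ∈ End(V^{n+1}) be the linear feed-forward operator (Āx)_j = a_0 x_j + Σ_{i=1}^n ā_i x_{max(j−i,0)}, and define Ā_S ∈ End(V^{n+1}) by (Ā_S x)_j = a_0 x_j + (ā_1 + ⋯ + ā_n) x_0, and Ā_N := Ā − Ā_S. Then Ā_N is nilpotent and Ā_S Ā_N = Ā_N Ā_S. -/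
/-- The operator `a N_i ∈ End(V^{n+1})`, `(a N_i x)_j = a (x_{max(j-i,0)})`. -/
def ffN (n : ℕ) (V : Type*) [AddCommGroup V] [Module ℝ V] (i : ℕ) (a : Module.End ℝ V) :
    Module.End ℝ (Fin (n + 1) → V) :=
  LinearMap.pi fun j : Fin (n + 1) =>
    a ∘ₗ LinearMap.proj (⟨j.val - i, Nat.lt_of_le_of_lt (Nat.sub_le _ _) j.isLt⟩ : Fin (n + 1))

/-- The linear feed-forward operator `(Ā x)_j = a₀ x_j + Σ_{i=1}^n ā_i x_{max(j-i,0)}`. -/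
def ffAbar (n : ℕ) (V : Type*) [AddCommGroup V] [Module ℝ V]
    (a0 : Module.End ℝ V) (abar : ℕ → Module.End ℝ V) : Module.End ℝ (Fin (n + 1) → V) :=
  ffN n V 0 a0 + ∑ i ∈ Finset.Icc 1 n, ffN n V i (abar i)

/-- The candidate semisimple part `(Ā_S x)_j = a₀ x_j + (ā_1 + ⋯ + ā_n) x_0`. -/
def ffAbarS (n : ℕ) (V : Type*) [AddCommGroup V] [Module ℝ V]
    (a0 : Module.End ℝ V) (abar : ℕ → Module.End ℝ V) : Module.End ℝ (Fin (n + 1) → V) :=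
  ffN n V 0 a0 + ffN n V n (∑ i ∈ Finset.Icc 1 n, abar i)

theorem ffN_apply {n : ℕ} {V : Type*} [AddCommGroup V] [Module ℝ V] (i : ℕ)
    (a : Module.End ℝ V) (x : Fin (n + 1) → V) (j : Fin (n + 1)) :
    ffN n V i a x j = a (x ⟨j.val - i, Nat.lt_of_le_of_lt (Nat.sub_le _ _) j.isLt⟩) :=
  rfl

theorem ffAbarS_apply {n : ℕ} {V : Type*} [AddCommGroup V] [Module ℝ V]
    (a0 : Module.End ℝ V) (abar : ℕ → Module.End ℝ V) (x : Fin (n + 1) → V) (j : Fin (n + 1)) :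
    ffAbarS n V a0 abar x j = a0 (x j) + ∑ i ∈ Finset.Icc 1 n, abar i (x 0) := by
  have h : (⟨j.val - n, Nat.lt_of_le_of_lt (Nat.sub_le _ _) j.isLt⟩ : Fin (n + 1)) = 0 :=
    Fin.ext (by simp; omega)
  simp [ffAbarS, ffN_apply, h, LinearMap.sum_apply]

theorem ffAbar_sub_ffAbarS_apply {n : ℕ} {V : Type*} [AddCommGroup V] [Module ℝ V]
    (a0 : Module.End ℝ V) (abar : ℕ → Module.End ℝ V) (x : Fin (n + 1) → V) (j : Fin (n + 1)) :
    (ffAbar n V a0 abar - ffAbarS n V a0 abar) x j = ∑ i ∈ Finset.Icc 1 n,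
      abar i (x ⟨j.val - i, Nat.lt_of_le_of_lt (Nat.sub_le _ _) j.isLt⟩ - x 0) := by
  rw [LinearMap.sub_apply, Pi.sub_apply, ffAbarS_apply]
  simp [ffAbar, ffN_apply, LinearMap.sum_apply, Finset.sum_apply]

theorem ffAbar_sub_ffAbarS_pow_apply_eq_zero {n : ℕ} {V : Type*} [AddCommGroup V] [Module ℝ V]
    (a0 : Module.End ℝ V) (abar : ℕ → Module.End ℝ V) (x : Fin (n + 1) → V) (k : ℕ)
    (j : Fin (n + 1)) (hj : j.val ≤ k) :
    ((ffAbar n V a0 abar - ffAbarS n V a0 abar) ^ (k + 1)) x j = 0 := by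
  induction k generalizing j with
  | zero =>
    obtain rfl : j = 0 := Fin.ext (by simpa using hj)
    rw [zero_add, pow_one, ffAbar_sub_ffAbarS_apply]
    simp
  | succ k ih =>
    rw [pow_succ', Module.End.mul_apply, ffAbar_sub_ffAbarS_apply]
    refine Finset.sum_eq_zero fun i hi => ?_
    have hi' := (Finset.mem_Icc.mp hi).1
    rw [ih _ (show j.val - i ≤ k by omega), ih 0 (Nat.zero_le k), sub_zero, map_zero]

/-- If `a₀` commutes with `ā_1, …, ā_{n-1}`, then
`Ā_N := Ā - Ā_S` is nilpotent and commutes with `Ā_S`. -/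
theorem ffAbarN_nilpotent_commute (n : ℕ) (hn : 1 ≤ n) (V : Type*)
    [AddCommGroup V] [Module ℝ V] [FiniteDimensional ℝ V]
    (a0 : Module.End ℝ V) (abar : ℕ → Module.End ℝ V)
    (hcomm : ∀ i, 1 ≤ i → i ≤ n - 1 → a0 * abar i = abar i * a0) :
    IsNilpotent (ffAbar n V a0 abar - ffAbarS n V a0 abar) ∧
    Commute (ffAbarS n V a0 abar) (ffAbar n V a0 abar - ffAbarS n V a0 abar) := by
  constructor
  · refine ⟨n + 1, LinearMap.ext fun x => funext fun j => ?_⟩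
    exact ffAbar_sub_ffAbarS_pow_apply_eq_zero a0 abar x n j (Nat.le_of_lt_succ j.isLt)
  · refine LinearMap.ext fun x => funext fun j => ?_
    have h0 (y : Fin (n + 1) → V) : (ffAbar n V a0 abar - ffAbarS n V a0 abar) y 0 = 0 := by
      simpa using ffAbar_sub_ffAbarS_pow_apply_eq_zero a0 abar y 0 0 le_rfl
    rw [Module.End.mul_apply, Module.End.mul_apply, ffAbarS_apply, h0, ffAbar_sub_ffAbarS_apply,
      ffAbar_sub_ffAbarS_apply, map_sum]
    simp only [map_zero, Finset.sum_const_zero, add_zero]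
    refine Finset.sum_congr rfl fun i hi => ?_
    rw [ffAbarS_apply, ffAbarS_apply, add_sub_add_right_eq_sub, ← map_sub]
    obtain ⟨hi1, hin⟩ := Finset.mem_Icc.mp hi
    rcases hin.eq_or_lt with rfl | hlt
    · have hz : (⟨j.val - i, Nat.lt_of_le_of_lt (Nat.sub_le _ _) j.isLt⟩ : Fin (i + 1)) = 0 :=
        Fin.ext (by simp; omega)
      simp [hz]
    · exact LinearMap.congr_fun (hcomm i hi1 (by omega)) _
end

section
/- Let V be a finite-dimensional real vector space and let a ∈ End(V) be semisimple. Define ad_a : End(V) → End(V) by ad_a(b) = ab − ba. Then End(V) is the internal direct sum of the range of ad_a and the kernel of ad_a: End(V) = im(ad_a) ⊕ ker(ad_a). In particular, every a_1 ∈ End(V) can be written uniquely as a_1 = ad_a(b) + c with c commuting with a. -/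
/-- The adjoint map `ad_a : End(V) → End(V)`, `ad_a(b) = ab - ba`, as a linear map. -/
noncomputable def adE (V : Type*) [AddCommGroup V] [Module ℝ V] (a : Module.End ℝ V) :
    Module.End ℝ V →ₗ[ℝ] Module.End ℝ V :=
  LinearMap.mulLeft ℝ a - LinearMap.mulRight ℝ a

/-- The range and the kernel of a semisimple endomorphism are complementary. -/
theorem Module.End.IsSemisimple.isCompl_range_ker {K M : Type*} [Field K] [AddCommGroup M]
    [Module K M] [FiniteDimensional K M] {f : Module.End K M} (hf : f.IsSemisimple) :
    IsCompl (LinearMap.range f) (LinearMap.ker f) := by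
  obtain ⟨q, hq, hc⟩ := Module.End.isSemisimple_iff.mp hf (LinearMap.ker f) fun x hx ↦ by
    simp [LinearMap.mem_ker.mp hx]
  have hle : LinearMap.range f ≤ q := by
    rintro _ ⟨x, rfl⟩
    obtain ⟨y, hy, z, hz, rfl⟩ :=
      Submodule.mem_sup.mp (hc.sup_eq_top ▸ Submodule.mem_top : x ∈ LinearMap.ker f ⊔ q)
    rw [map_add, LinearMap.mem_ker.mp hy, zero_add]
    exact hq hz
  exact (Submodule.isCompl_iff_disjoint _ _ f.finrank_range_add_finrank_ker.ge).mpr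
    (hc.disjoint.symm.mono_left hle)

theorem adE_isSemisimple {V : Type*} [AddCommGroup V] [Module ℝ V] [FiniteDimensional ℝ V]
    {a : Module.End ℝ V} (ha : a.IsSemisimple) : Module.End.IsSemisimple (adE V a) := by
  let _ : LieRing (Module.End ℝ V) := LieRing.ofAssociativeRing
  have h : adE V a = LieAlgebra.ad ℝ (Module.End ℝ V) a := by
    rw [LieAlgebra.ad_eq_lmul_left_sub_lmul_right]
    rfl
  rw [h]
  exact LieAlgebra.ad_isSemisimple_of_isSemisimple ha

theorem mem_ker_adE_iff {V : Type*} [AddCommGroup V] [Module ℝ V] {a c : Module.End ℝ V} :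
    c ∈ LinearMap.ker (adE V a) ↔ Commute a c := by
  simp [adE, sub_eq_zero, commute_iff_eq]

/-- If `a ∈ End(V)` is semisimple (`V` finite-dimensional real),
then `End(V) = im(ad_a) ⊕ ker(ad_a)`; in particular every `a₁ ∈ End(V)` decomposes
uniquely as `a₁ = ad_a(b) + c` with `c` commuting with `a`. -/
theorem end_decomposition_of_semisimple (V : Type*) [AddCommGroup V] [Module ℝ V]
    [FiniteDimensional ℝ V] (a : Module.End ℝ V) (ha : a.IsSemisimple) :
    IsCompl (LinearMap.range (adE V a)) (LinearMap.ker (adE V a)) ∧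
    ∀ a₁ : Module.End ℝ V, ∃! p : Module.End ℝ V × Module.End ℝ V,
      a₁ = p.1 + p.2 ∧ (∃ b, adE V a b = p.1) ∧ Commute a p.2 := by
  have hc := (adE_isSemisimple ha).isCompl_range_ker
  refine ⟨hc, fun a₁ ↦ ?_⟩
  obtain ⟨⟨u, v⟩, huv, huniq⟩ := Submodule.existsUnique_add_of_isCompl_prod hc a₁
  refine ⟨(u, v), ⟨huv.symm, u.2, mem_ker_adE_iff.mp v.2⟩, ?_⟩
  rintro ⟨x, y⟩ ⟨hxy, hx, hy⟩
  have h := huniq (⟨x, hx⟩, ⟨y, mem_ker_adE_iff.mpr hy⟩) hxy.symm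
  exact congrArg (fun p ↦ ((p.1 : Module.End ℝ V), (p.2 : Module.End ℝ V))) h
end

section
/- Let n ≥ 1, let V be a finite-dimensional real vector space, let a_0, …, a_n ∈ End(V), and let A ∈ End(V^{n+1}) be the linear feed-forward operator (Ax)_j = Σ_{i=0}^n a_i x_{max(j−i,0)}. Then the characteristic polynomial of A equals the product of the characteristic polynomial of a_0 + a_1 + ⋯ + a_n and the n-th power of the characteristic polynomial of a_0: χ_A = χ_{a_0+⋯+a_n} · (χ_{a_0})^n. In particular every (complex) eigenvalue of a_0 occurs at least n times (with multiplicity) as an eigenvalue of A. -/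
/-- The linear feed-forward operator `(A x)_j = Σ_{i=0}^n a_i x_{max(j-i,0)}`. -/
def ffOp (n : ℕ) (V : Type*) [AddCommGroup V] [Module ℝ V]
    (a : Fin (n + 1) → Module.End ℝ V) : Module.End ℝ (Fin (n + 1) → V) :=
  ∑ i : Fin (n + 1), ffN n V i.val (a i)

/-- The characteristic polynomial of a block lower triangular endomorphism of `κ → V` is the
product of the characteristic polynomials of its diagonal blocks. -/
theorem LinearMap.charpoly_pi_of_lowerTriangular {R κ V : Type*} [CommRing R] [AddCommGroup V]
    [Module R V] [Module.Free R V] [Module.Finite R V] [Fintype κ] [LinearOrder κ]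
    (L : Module.End R (κ → V)) (hL : ∀ j k v, j < k → L (Pi.single k v) j = 0) :
    L.charpoly =
      ∏ k, (LinearMap.proj k ∘ₗ L ∘ₗ LinearMap.single R (fun _ => V) k).charpoly := by
  classical
  let b := Module.Free.chooseBasis R V
  let B := Pi.basis fun _ : κ => b
  have hB : (LinearMap.toMatrix B B L).transpose.BlockTriangular Sigma.fst := by
    rintro ⟨j, r⟩ ⟨k, s⟩ hjk
    simp [B, LinearMap.toMatrix_apply, hL _ _ _ hjk]
  rw [← LinearMap.charpoly_toMatrix L B, ← Matrix.charpoly_transpose, Matrix.charpoly,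
    hB.charmatrix.det_fintype]
  refine Finset.prod_congr rfl fun k _ => ?_
  rw [← LinearMap.charpoly_toMatrix _ b, ← Matrix.charpoly_transpose,
    ← Matrix.charpoly_reindex (Equiv.sigmaSubtype (β := fun _ : κ => _) k).symm,
    ← Matrix.charmatrix_toSquareBlock, ← Matrix.charpoly]
  congr 1
  ext ⟨⟨j, r⟩, hj⟩ ⟨⟨k', s⟩, hk⟩
  cases hj
  cases hk
  simp [B, LinearMap.toMatrix_apply, Matrix.toSquareBlock_def, Equiv.sigmaSubtype]

theorem ffOp_apply (n : ℕ) (V : Type*) [AddCommGroup V] [Module ℝ V]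
    (a : Fin (n + 1) → Module.End ℝ V) (x : Fin (n + 1) → V) (j : Fin (n + 1)) :
    ffOp n V a x j = ∑ i : Fin (n + 1), a i (x ⟨j - i, by omega⟩) := by
  simp [ffOp, ffN]

/-- The characteristic polynomial of the feed-forward operator `A`
is `χ_{a₀+⋯+aₙ} · (χ_{a₀})^n`; in particular every complex eigenvalue of `a₀` occurs
at least `n` times (with multiplicity) as an eigenvalue of `A`. -/
theorem ffOp_charpoly (n : ℕ) (hn : 1 ≤ n) (V : Type*)
    [AddCommGroup V] [Module ℝ V] [FiniteDimensional ℝ V]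
    (a : Fin (n + 1) → Module.End ℝ V) :
    (ffOp n V a).charpoly = (∑ i : Fin (n + 1), a i).charpoly * (a 0).charpoly ^ n ∧
    ∀ z : ℂ,
      n * Polynomial.rootMultiplicity z ((a 0).charpoly.map (algebraMap ℝ ℂ)) ≤
        Polynomial.rootMultiplicity z ((ffOp n V a).charpoly.map (algebraMap ℝ ℂ)) := by
  have hlower : ∀ j k v, j < k → ffOp n V a (Pi.single k v) j = 0 := by
    intro j k v hjk
    rw [ffOp_apply]
    refine Finset.sum_eq_zero fun i _ => ?_
    rw [Pi.single_eq_of_ne (by simp only [ne_eq, Fin.ext_iff]; omega), map_zero]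
  have hzero : LinearMap.proj 0 ∘ₗ ffOp n V a ∘ₗ LinearMap.single ℝ (fun _ => V) 0 =
      ∑ i, a i := by
    ext v
    simp only [LinearMap.comp_apply, LinearMap.proj_apply, LinearMap.single_apply, ffOp_apply,
      LinearMap.sum_apply]
    refine Finset.sum_congr rfl fun i _ => ?_
    simp [Pi.single_apply]
  have hsucc (k : Fin n) : LinearMap.proj k.succ ∘ₗ ffOp n V a ∘ₗ
      LinearMap.single ℝ (fun _ => V) k.succ = a 0 := by
    ext v
    simp only [LinearMap.comp_apply, LinearMap.proj_apply, LinearMap.single_apply, ffOp_apply]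
    rw [Finset.sum_eq_single 0]
    · simp [Pi.single_apply, Fin.ext_iff]
    · intro i _ hi
      rw [Pi.single_eq_of_ne, map_zero]
      simp only [ne_eq, Fin.ext_iff, Fin.val_succ, Fin.val_zero] at hi ⊢
      omega
    · simp
  have hchar : (ffOp n V a).charpoly = (∑ i, a i).charpoly * (a 0).charpoly ^ n := by
    rw [LinearMap.charpoly_pi_of_lowerTriangular _ hlower, Fin.prod_univ_succ, hzero]
    simp [hsucc]
  refine ⟨hchar, fun z => ?_⟩
  have hsum := ((∑ i, a i).charpoly_monic.map (algebraMap ℝ ℂ)).ne_zero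
  have hpow := pow_ne_zero n ((a 0).charpoly_monic.map (algebraMap ℝ ℂ)).ne_zero
  rw [hchar, Polynomial.map_mul, Polynomial.map_pow,
    Polynomial.rootMultiplicity_mul (mul_ne_zero hsum hpow), ← Polynomial.count_roots,
    ← Polynomial.count_roots ((_ : Polynomial ℂ) ^ n), Polynomial.roots_pow, Multiset.count_nsmul]
  exact Nat.le_add_left _ _
end
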